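/- arXiv:1604.05996 — 10 statements merged into one kernel-verified Lean document; each statement's English description precedes it below -/
import Mathlib

section
/- Let A be a vector space over a field k of characteristic zero equipped with a trilinear bracket [·,·,·] that is alternating (skew-symmetric in its three arguments). Then (A,[·,·,·]) is a 3-Lie algebra (i.e. satisfies the Fundamental Identity) if and only if for all x1,x2,x3,x4,x5 in A both of the following hold: (a) [[x1,x2,x3],x4,x5] − [[x1,x2,x4],x3,x5] + [[x1,x3,x4],x2,x5] − [[x2,x3,x4],x1,x5] = 0; (b) [[x1,x2,x5],x3,x4] + [[x3,x4,x5],x1,x2] − [[x1,x3,x5],x2,x4] − [[x2,x4,x5],x1,x3] + [[x1,x4,x5],x2,x3] + [[x2,x3,x5],x1,x4] = 0. -/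
/-- A trilinear alternating bracket on a vector space `A` over a field of
characteristic zero satisfies the Fundamental Identity of a 3-Lie algebra if and only if
the two identities (a) and (b) hold. -/
theorem stmt0 {k A : Type*} [Field k] [CharZero k] [AddCommGroup A] [Module k A]
    (f : A →ₗ[k] A →ₗ[k] A →ₗ[k] A)
    (hskew12 : ∀ x y z : A, f x y z = - f y x z)
    (hskew23 : ∀ x y z : A, f x y z = - f x z y) :
    (∀ x1 x2 x3 x4 x5 : A,
        f x1 x2 (f x3 x4 x5) =
          f (f x1 x2 x3) x4 x5 + f x3 (f x1 x2 x4) x5 + f x3 x4 (f x1 x2 x5)) ↔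
      ((∀ x1 x2 x3 x4 x5 : A,
          f (f x1 x2 x3) x4 x5 - f (f x1 x2 x4) x3 x5 + f (f x1 x3 x4) x2 x5
            - f (f x2 x3 x4) x1 x5 = 0) ∧
        (∀ x1 x2 x3 x4 x5 : A,
          f (f x1 x2 x5) x3 x4 + f (f x3 x4 x5) x1 x2 - f (f x1 x3 x5) x2 x4
            - f (f x2 x4 x5) x1 x3 + f (f x1 x4 x5) x2 x3 + f (f x2 x3 x5) x1 x4 = 0)) := by
  have cyc (x y z : A) : f x y z = f z x y := by rw [hskew23, hskew12, neg_neg]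
  constructor
  · intro h
    have h' (x1 x2 x3 x4 x5 : A) : f (f x3 x4 x5) x1 x2 =
        f (f x1 x2 x3) x4 x5 - f (f x1 x2 x4) x3 x5 + f (f x1 x2 x5) x3 x4 := by
      rw [← cyc x1 x2 (f x3 x4 x5), h, hskew12 x3 (f x1 x2 x4) x5, cyc x3 x4 (f x1 x2 x5)]
      abel
    refine ⟨fun x1 x2 x3 x4 x5 => ?_, fun x1 x2 x3 x4 x5 => ?_⟩
    · have h1 := h' x1 x2 x3 x4 x5
      have h2 := h' x3 x4 x1 x2 x5
      rw [cyc x3 x4 x1, cyc x3 x4 x2] at h2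
      linear_combination (norm := abel) -h1 - h2
    · have h1 := h' x1 x2 x3 x4 x5
      have h2 := h' x3 x5 x1 x2 x4
      have h3 := h' x4 x5 x1 x2 x3
      rw [cyc x3 x5 x1, cyc x3 x5 x2, hskew23 x3 x5 x4, map_neg, LinearMap.neg_apply,
        LinearMap.neg_apply] at h2
      rw [cyc x4 x5 x1, cyc x4 x5 x2, cyc x4 x5 x3] at h3
      linear_combination (norm := abel) -h1 + h2 - h3
  · rintro ⟨ha, hb⟩ x1 x2 x3 x4 x5
    have h1 := ha x1 x3 x4 x5 x2
    have h2 := hb x2 x3 x4 x5 x1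
    rw [hskew23 _ x5 x2, hskew23 _ x4 x2, hskew23 _ x3 x2] at h1
    rw [cyc x2 x3 x1, cyc x4 x5 x1, cyc x2 x4 x1, cyc x3 x5 x1, cyc x2 x5 x1,
      cyc x3 x4 x1] at h2
    rw [cyc x1 x2 (f x3 x4 x5), hskew12 x3 (f x1 x2 x4) x5, cyc x3 x4 (f x1 x2 x5)]
    linear_combination (norm := abel) -h1 - h2
end

section
/- Let A be a 3-Lie algebra and let x_i, y_i (i ranging over a finite index set) be elements of A. Define linear maps Δ1, Δ2, Δ3 : A → A⊗A⊗A by Δ1(x) = Σ_{i,j} [x,x_i,x_j]⊗y_j⊗y_i, Δ2(x) = Σ_{i,j} y_i⊗[x,x_i,x_j]⊗y_j, and Δ3(x) = Σ_{i,j} y_j⊗y_i⊗[x,x_i,x_j]. Then for all x,y,z in A: Δ1([x,y,z]) = (ad_{y,z}⊗1⊗1)Δ1(x) + (ad_{z,x}⊗1⊗1)Δ1(y) + (ad_{x,y}⊗1⊗1)Δ1(z); Δ2([x,y,z]) = (1⊗ad_{y,z}⊗1)Δ2(x) + (1⊗ad_{z,x}⊗1)Δ2(y) + (1⊗ad_{x,y}⊗1)Δ2(z);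 and Δ3([x,y,z]) = (1⊗1⊗ad_{y,z})Δ3(x) + (1⊗1⊗ad_{z,x})Δ3(y) + (1⊗1⊗ad_{x,y})Δ3(z). -/
open TensorProduct

section

variable (k : Type*) {A : Type*} [Field k] [AddCommGroup A] [Module k A]

/-- `Δ₁(x) = Σ_{i,j} [x,xᵢ,xⱼ] ⊗ yⱼ ⊗ yᵢ`. -/
noncomputable def delta1 (f : A →ₗ[k] A →ₗ[k] A →ₗ[k] A) {ι : Type*} [Fintype ι]
    (xs ys : ι → A) (x : A) : (A ⊗[k] A) ⊗[k] A :=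
  ∑ i : ι, ∑ j : ι, ((f x (xs i) (xs j)) ⊗ₜ[k] (ys j)) ⊗ₜ[k] (ys i)

/-- `Δ₂(x) = Σ_{i,j} yᵢ ⊗ [x,xᵢ,xⱼ] ⊗ yⱼ`. -/
noncomputable def delta2 (f : A →ₗ[k] A →ₗ[k] A →ₗ[k] A) {ι : Type*} [Fintype ι]
    (xs ys : ι → A) (x : A) : (A ⊗[k] A) ⊗[k] A :=
  ∑ i : ι, ∑ j : ι, ((ys i) ⊗ₜ[k] (f x (xs i) (xs j))) ⊗ₜ[k] (ys j)

/-- `Δ₃(x) = Σ_{i,j} yⱼ ⊗ yᵢ ⊗ [x,xᵢ,xⱼ]`. -/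
noncomputable def delta3 (f : A →ₗ[k] A →ₗ[k] A →ₗ[k] A) {ι : Type*} [Fintype ι]
    (xs ys : ι → A) (x : A) : (A ⊗[k] A) ⊗[k] A :=
  ∑ i : ι, ∑ j : ι, ((ys j) ⊗ₜ[k] (ys i)) ⊗ₜ[k] (f x (xs i) (xs j))

end

/-- The fundamental identity with all brackets written as `ad` acting on the last argument: for
fixed `u, v`, the map `x ↦ [x,u,v]` is a 1-cocycle for the adjoint representation. -/
theorem bracket_bracket_left {k A : Type*} [Field k] [AddCommGroup A] [Module k A]
    (f : A →ₗ[k] A →ₗ[k] A →ₗ[k] A)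
    (hskew12 : ∀ x y z : A, f x y z = - f y x z)
    (hskew23 : ∀ x y z : A, f x y z = - f x z y)
    (hfi : ∀ x1 x2 x3 x4 x5 : A,
      f x1 x2 (f x3 x4 x5) =
        f (f x1 x2 x3) x4 x5 + f x3 (f x1 x2 x4) x5 + f x3 x4 (f x1 x2 x5))
    (x y z u v : A) :
    f (f x y z) u v = f y z (f x u v) + f z x (f y u v) + f x y (f z u v) := by
  have cyc : ∀ a b c : A, f a b c = f b c a := fun a b c => by
    rw [hskew12 a b c, hskew23 b a c, neg_neg]
  rw [cyc (f x y z) u v, hfi, cyc (f u v x) y z, ← cyc z x (f u v y),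
    cyc x u v, cyc y u v, cyc z u v]

/-- each `Δₘ` (m = 1,2,3) is a 1-cocycle for the corresponding representation
`ad⊗1⊗1`, `1⊗ad⊗1`, `1⊗1⊗ad` of the 3-Lie algebra on `A ⊗ A ⊗ A`. -/
theorem stmt5 {k A : Type*} [Field k] [CharZero k] [AddCommGroup A] [Module k A]
    (f : A →ₗ[k] A →ₗ[k] A →ₗ[k] A)
    (hskew12 : ∀ x y z : A, f x y z = - f y x z)
    (hskew23 : ∀ x y z : A, f x y z = - f x z y)
    (hfi : ∀ x1 x2 x3 x4 x5 : A,
      f x1 x2 (f x3 x4 x5) =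
        f (f x1 x2 x3) x4 x5 + f x3 (f x1 x2 x4) x5 + f x3 x4 (f x1 x2 x5))
    {ι : Type*} [Fintype ι] (xs ys : ι → A) :
    (∀ x y z : A,
      delta1 k f xs ys (f x y z) =
        LinearMap.rTensor A (LinearMap.rTensor A (f y z)) (delta1 k f xs ys x)
        + LinearMap.rTensor A (LinearMap.rTensor A (f z x)) (delta1 k f xs ys y)
        + LinearMap.rTensor A (LinearMap.rTensor A (f x y)) (delta1 k f xs ys z)) ∧
    (∀ x y z : A,
      delta2 k f xs ys (f x y z) =
        LinearMap.rTensor A (LinearMap.lTensor A (f y z)) (delta2 k f xs ys x)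
        + LinearMap.rTensor A (LinearMap.lTensor A (f z x)) (delta2 k f xs ys y)
        + LinearMap.rTensor A (LinearMap.lTensor A (f x y)) (delta2 k f xs ys z)) ∧
    (∀ x y z : A,
      delta3 k f xs ys (f x y z) =
        LinearMap.lTensor (A ⊗[k] A) (f y z) (delta3 k f xs ys x)
        + LinearMap.lTensor (A ⊗[k] A) (f z x) (delta3 k f xs ys y)
        + LinearMap.lTensor (A ⊗[k] A) (f x y) (delta3 k f xs ys z)) := by
  have key := bracket_bracket_left f hskew12 hskew23 hfi
  refine ⟨fun x y z => ?_, fun x y z => ?_, fun x y z => ?_⟩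
  · simp only [delta1, map_sum, LinearMap.rTensor_tmul, key, add_tmul, Finset.sum_add_distrib]
  · simp only [delta2, map_sum, LinearMap.rTensor_tmul, LinearMap.lTensor_tmul, key, add_tmul,
      tmul_add, Finset.sum_add_distrib]
  · simp only [delta3, map_sum, LinearMap.lTensor_tmul, key, tmul_add, Finset.sum_add_distrib]
end

section
/- Let A be a finite-dimensional 3-Lie algebra over a field k of characteristic zero and let x_i, y_i (finite family) represent r = Σ_i x_i⊗y_i ∈ A⊗A. Suppose r is skew-symmetric (σ12(r) = −r) and r satisfies the 3-Lie classical Yang–Baxter equation [[r,r,r]] = 0. Then the trilinear bracket on the dual space A* defined by [ξ,η,γ]* := ad*_{r(ξ),r(η)}γ + ad*_{r(η),r(γ)}ξ + ad*_{r(γ),r(ξ)}η makes A* a 3-Lie algebra. -/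
open TensorProduct

section

variable (k : Type*) {A : Type*} [Field k] [AddCommGroup A] [Module k A]

/-- The linear map `A* → A` induced by `r = Σᵢ xᵢ ⊗ yᵢ ∈ A ⊗ A`: `r(ξ) = Σᵢ ξ(xᵢ) yᵢ`. -/
noncomputable def rMap {ι : Type*} [Fintype ι] (xs ys : ι → A) (ξ : Module.Dual k A) : A :=
  ∑ i : ι, ξ (xs i) • ys i

/-- The coadjoint action: `⟨ad*_{x,y} ξ, z⟩ = -⟨ξ, [x,y,z]⟩`. -/
noncomputable def coad (f : A →ₗ[k] A →ₗ[k] A →ₗ[k] A) (x y : A) :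
    Module.Dual k A →ₗ[k] Module.Dual k A :=
  - (f x y).dualMap

/-- The bracket `[ξ,η,γ]* = ad*_{r(ξ),r(η)} γ + ad*_{r(η),r(γ)} ξ + ad*_{r(γ),r(ξ)} η`
on the dual space induced by `r`. -/
noncomputable def dualBr (f : A →ₗ[k] A →ₗ[k] A →ₗ[k] A) {ι : Type*} [Fintype ι]
    (xs ys : ι → A) (ξ η γ : Module.Dual k A) : Module.Dual k A :=
  coad k f (rMap k xs ys ξ) (rMap k xs ys η) γ
  + coad k f (rMap k xs ys η) (rMap k xs ys γ) ξ
  + coad k f (rMap k xs ys γ) (rMap k xs ys ξ) η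

end

section

variable {k A : Type*} [Field k] [AddCommGroup A] [Module k A]

theorem dualBr_apply (f : A →ₗ[k] A →ₗ[k] A →ₗ[k] A) {ι : Type*} [Fintype ι]
    (xs ys : ι → A) (ξ η γ : Module.Dual k A) (z : A) :
    dualBr k f xs ys ξ η γ z =
      - γ (f (rMap k xs ys ξ) (rMap k xs ys η) z) - ξ (f (rMap k xs ys η) (rMap k xs ys γ) z)
        - η (f (rMap k xs ys γ) (rMap k xs ys ξ) z) := by
  simp only [dualBr, coad, LinearMap.add_apply, LinearMap.neg_apply, LinearMap.dualMap_apply]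
  ring

theorem apply_rMap {ι : Type*} [Fintype ι] (xs ys : ι → A) (ξ η : Module.Dual k A) :
    η (rMap k xs ys ξ) = ∑ i : ι, ξ (xs i) * η (ys i) := by
  simp [rMap]

/-- A skew-symmetric tensor induces a skew-adjoint map `A* → A`. -/
theorem apply_rMap_skew {ι : Type*} [Fintype ι] {xs ys : ι → A}
    (hskewr : (∑ i : ι, (ys i) ⊗ₜ[k] (xs i)) = - ∑ i : ι, (xs i) ⊗ₜ[k] (ys i))
    (ξ η : Module.Dual k A) :
    η (rMap k xs ys ξ) = - ξ (rMap k xs ys η) := by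
  have h := congrArg (LinearMap.mul' k k ∘ₗ TensorProduct.map η ξ) hskewr
  simp only [map_sum, map_neg, LinearMap.comp_apply, TensorProduct.map_tmul,
    LinearMap.mul'_apply] at h
  rw [apply_rMap, apply_rMap, ← h]
  exact Finset.sum_congr rfl fun i _ => mul_comm _ _

theorem rMap_swap {ι : Type*} [Fintype ι] {xs ys : ι → A}
    (hskewr : (∑ i : ι, (ys i) ⊗ₜ[k] (xs i)) = - ∑ i : ι, (xs i) ⊗ₜ[k] (ys i))
    (ξ : Module.Dual k A) :
    ∑ i : ι, ξ (ys i) • xs i = - rMap k xs ys ξ := by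
  have h := congrArg (TensorProduct.lift (LinearMap.toSpanSingleton k _ LinearMap.id ∘ₗ ξ)) hskewr
  simpa [rMap] using h

/-- The pairing of `[[r,r,r]]` with four functionals, for skew-symmetric `r`. -/
theorem cybe_apply (f : A →ₗ[k] A →ₗ[k] A →ₗ[k] A) {ι : Type*} [Fintype ι] {xs ys : ι → A}
    (hskewr : (∑ i : ι, (ys i) ⊗ₜ[k] (xs i)) = - ∑ i : ι, (xs i) ⊗ₜ[k] (ys i))
    (hcybe : (∑ i : ι, ∑ j : ι, ∑ l : ι,
        ((((f (xs i) (xs j) (xs l)) ⊗ₜ[k] (ys i)) ⊗ₜ[k] (ys j)) ⊗ₜ[k] (ys l)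
        + (((xs i) ⊗ₜ[k] (f (ys i) (xs j) (xs l))) ⊗ₜ[k] (ys j)) ⊗ₜ[k] (ys l)
        + (((xs i) ⊗ₜ[k] (xs j)) ⊗ₜ[k] (f (ys i) (ys j) (xs l))) ⊗ₜ[k] (ys l)
        + (((xs i) ⊗ₜ[k] (xs j)) ⊗ₜ[k] (xs l)) ⊗ₜ[k] (f (ys i) (ys j) (ys l)))) =
      (0 : ((A ⊗[k] A) ⊗[k] A) ⊗[k] A))
    (ξ η γ δ : Module.Dual k A) :
    - ξ (f (rMap k xs ys η) (rMap k xs ys γ) (rMap k xs ys δ))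
      + η (f (rMap k xs ys ξ) (rMap k xs ys γ) (rMap k xs ys δ))
      - γ (f (rMap k xs ys ξ) (rMap k xs ys η) (rMap k xs ys δ))
      + δ (f (rMap k xs ys ξ) (rMap k xs ys η) (rMap k xs ys γ)) = 0 := by
  have expand : ∀ (φ : Module.Dual k A) (a b c : ι → k) (u v w : ι → A),
      φ (f (∑ i, a i • u i) (∑ i, b i • v i) (∑ i, c i • w i)) =
        ∑ i, ∑ j, ∑ l, a i * b j * c l * φ (f (u i) (v j) (w l)) := by
    intro φ a b c u v w
    rw [map_sum f, LinearMap.sum_apply, LinearMap.sum_apply, map_sum φ]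
    refine Finset.sum_congr rfl fun i _ => ?_
    rw [map_sum (f _), LinearMap.sum_apply, map_sum φ]
    refine Finset.sum_congr rfl fun j _ => ?_
    rw [map_sum, map_sum φ]
    refine Finset.sum_congr rfl fun l _ => ?_
    simp only [map_smul, LinearMap.smul_apply, smul_eq_mul]
    ring
  have h := congrArg (LinearMap.mul' k k ∘ₗ TensorProduct.map (LinearMap.mul' k k ∘ₗ
    TensorProduct.map (LinearMap.mul' k k ∘ₗ TensorProduct.map ξ η) γ) δ) hcybe
  simp only [map_sum, map_add, map_zero, LinearMap.comp_apply, TensorProduct.map_tmul,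
    LinearMap.mul'_apply, Finset.sum_add_distrib] at h
  have swap := rMap_swap hskewr
  have h₁ := expand ξ (fun i => η (ys i)) (fun i => γ (ys i)) (fun i => δ (ys i)) xs xs xs
  have h₂ := expand η (fun i => ξ (xs i)) (fun i => γ (ys i)) (fun i => δ (ys i)) ys xs xs
  have h₃ := expand γ (fun i => ξ (xs i)) (fun i => η (xs i)) (fun i => δ (ys i)) ys ys xs
  have h₄ := expand δ (fun i => ξ (xs i)) (fun i => η (xs i)) (fun i => γ (xs i)) ys ys ys
  simp only [swap, ← rMap.eq_1, map_neg, LinearMap.neg_apply, neg_neg] at h₁ h₂ h₃ h₄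
  rw [sub_eq_add_neg, h₁, h₂, h₃, h₄, ← h]
  simp only [← Finset.sum_add_distrib]
  refine Finset.sum_congr rfl fun i _ => Finset.sum_congr rfl fun j _ =>
    Finset.sum_congr rfl fun l _ => ?_
  ring

/-- A skew-symmetric solution of the 3-Lie classical Yang–Baxter equation intertwines the bracket
on the dual space with the bracket of the 3-Lie algebra. -/
theorem rMap_dualBr (f : A →ₗ[k] A →ₗ[k] A →ₗ[k] A)
    (hskew12 : ∀ x y z : A, f x y z = - f y x z) {ι : Type*} [Fintype ι] {xs ys : ι → A}
    (hskewr : (∑ i : ι, (ys i) ⊗ₜ[k] (xs i)) = - ∑ i : ι, (xs i) ⊗ₜ[k] (ys i))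
    (hcybe : (∑ i : ι, ∑ j : ι, ∑ l : ι,
        ((((f (xs i) (xs j) (xs l)) ⊗ₜ[k] (ys i)) ⊗ₜ[k] (ys j)) ⊗ₜ[k] (ys l)
        + (((xs i) ⊗ₜ[k] (f (ys i) (xs j) (xs l))) ⊗ₜ[k] (ys j)) ⊗ₜ[k] (ys l)
        + (((xs i) ⊗ₜ[k] (xs j)) ⊗ₜ[k] (f (ys i) (ys j) (xs l))) ⊗ₜ[k] (ys l)
        + (((xs i) ⊗ₜ[k] (xs j)) ⊗ₜ[k] (xs l)) ⊗ₜ[k] (f (ys i) (ys j) (ys l)))) =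
      (0 : ((A ⊗[k] A) ⊗[k] A) ⊗[k] A))
    (ξ η γ : Module.Dual k A) :
    rMap k xs ys (dualBr k f xs ys ξ η γ) =
      f (rMap k xs ys ξ) (rMap k xs ys η) (rMap k xs ys γ) := by
  rw [← sub_eq_zero, ← Module.forall_dual_apply_eq_zero_iff k]
  intro δ
  rw [map_sub, sub_eq_zero]
  have h := cybe_apply f hskewr hcybe ξ η γ δ
  rw [apply_rMap_skew hskewr, dualBr_apply, hskew12 (rMap k xs ys γ) (rMap k xs ys ξ), map_neg]
  linear_combination -h

/-- The second representation condition for the coadjoint action of a 3-Lie algebra. -/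
theorem bracket_cyclic_sum (f : A →ₗ[k] A →ₗ[k] A →ₗ[k] A)
    (hskew12 : ∀ x y z : A, f x y z = - f y x z)
    (hskew23 : ∀ x y z : A, f x y z = - f x z y)
    (hfi : ∀ x1 x2 x3 x4 x5 : A,
      f x1 x2 (f x3 x4 x5) =
        f (f x1 x2 x3) x4 x5 + f x3 (f x1 x2 x4) x5 + f x3 x4 (f x1 x2 x5))
    (a b c d z : A) :
    f a (f b c d) z = - f a b (f c d z) - f a c (f d b z) - f a d (f b c z) := by
  have cyc : ∀ x y w : A, f x y w = f y w x := fun x y w => by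
    rw [hskew12, hskew23, neg_neg]
  have hs : f a (f b c d) z = f c d (f a b z) + f d b (f a c z) + f b c (f a d z) := by
    have h := hfi z a b c d
    rwa [cyc z a (f b c d), cyc z a b, cyc z a c, cyc z a d, cyc (f a b z),
      ← cyc d b (f a c z)] at h
  have e₁ : f c (f a b d) z = - f (f a b d) c z := hskew12 _ _ _
  have e₂ : f d (f a c b) z = f (f a b c) d z := by
    rw [hskew12, hskew23 a c b, map_neg, LinearMap.neg_apply, LinearMap.neg_apply, neg_neg]
  have e₃ : f (f a d b) c z = - f (f a b d) c z := by
    rw [hskew23 a d b, map_neg, LinearMap.neg_apply, LinearMap.neg_apply]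
  have e₄ : f b (f a d c) z = f (f a c d) b z := by
    rw [hskew12, hskew23 a d c, map_neg, LinearMap.neg_apply, LinearMap.neg_apply, neg_neg]
  have e₅ : f (f c d a) b z = f (f a c d) b z := by rw [cyc a c d]
  have e₆ : f a (f c d b) z = f a (f b c d) z := by rw [cyc b c d]
  have h₁ := hfi a b c d z
  have h₂ := hfi a c d b z
  have h₃ := hfi a d b c z
  have h₄ := hfi c d a b z
  rw [e₁] at h₁
  rw [e₂] at h₂
  rw [e₃, e₄] at h₃
  rw [e₅, e₆] at h₄
  linear_combination (norm := module) h₁ + h₂ + h₃ - hs - (2 : k) • (h₁ + h₄)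

end

/-- if `r = Σᵢ xᵢ ⊗ yᵢ` is a skew-symmetric solution of the 3-Lie classical
Yang–Baxter equation `[[r,r,r]] = 0` in a finite-dimensional 3-Lie algebra `A`, then the
bracket `[ξ,η,γ]* = ad*_{r(ξ),r(η)} γ + ad*_{r(η),r(γ)} ξ + ad*_{r(γ),r(ξ)} η`
makes `A*` a 3-Lie algebra. -/
theorem stmt7 {k A : Type*} [Field k] [CharZero k] [AddCommGroup A] [Module k A]
    [FiniteDimensional k A]
    (f : A →ₗ[k] A →ₗ[k] A →ₗ[k] A)
    (hskew12 : ∀ x y z : A, f x y z = - f y x z)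
    (hskew23 : ∀ x y z : A, f x y z = - f x z y)
    (hfi : ∀ x1 x2 x3 x4 x5 : A,
      f x1 x2 (f x3 x4 x5) =
        f (f x1 x2 x3) x4 x5 + f x3 (f x1 x2 x4) x5 + f x3 x4 (f x1 x2 x5))
    {ι : Type*} [Fintype ι] (xs ys : ι → A)
    (hskewr : (∑ i : ι, (ys i) ⊗ₜ[k] (xs i)) = - ∑ i : ι, (xs i) ⊗ₜ[k] (ys i))
    (hcybe : (∑ i : ι, ∑ j : ι, ∑ l : ι,
        ((((f (xs i) (xs j) (xs l)) ⊗ₜ[k] (ys i)) ⊗ₜ[k] (ys j)) ⊗ₜ[k] (ys l)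
        + (((xs i) ⊗ₜ[k] (f (ys i) (xs j) (xs l))) ⊗ₜ[k] (ys j)) ⊗ₜ[k] (ys l)
        + (((xs i) ⊗ₜ[k] (xs j)) ⊗ₜ[k] (f (ys i) (ys j) (xs l))) ⊗ₜ[k] (ys l)
        + (((xs i) ⊗ₜ[k] (xs j)) ⊗ₜ[k] (xs l)) ⊗ₜ[k] (f (ys i) (ys j) (ys l)))) =
      (0 : ((A ⊗[k] A) ⊗[k] A) ⊗[k] A)) :
    (∀ ξ η γ : Module.Dual k A,
      dualBr k f xs ys ξ η γ = - dualBr k f xs ys η ξ γ) ∧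
    (∀ ξ η γ : Module.Dual k A,
      dualBr k f xs ys ξ η γ = - dualBr k f xs ys ξ γ η) ∧
    (∀ ξ1 ξ2 ξ3 ξ4 ξ5 : Module.Dual k A,
      dualBr k f xs ys ξ1 ξ2 (dualBr k f xs ys ξ3 ξ4 ξ5) =
        dualBr k f xs ys (dualBr k f xs ys ξ1 ξ2 ξ3) ξ4 ξ5
        + dualBr k f xs ys ξ3 (dualBr k f xs ys ξ1 ξ2 ξ4) ξ5
        + dualBr k f xs ys ξ3 ξ4 (dualBr k f xs ys ξ1 ξ2 ξ5)) := by
  have hR := rMap_dualBr f hskew12 hskewr hcybe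
  have hS := bracket_cyclic_sum f hskew12 hskew23 hfi
  have skew : ∀ (φ : Module.Dual k A) (x y z : A), φ (f x y z) = - φ (f y x z) :=
    fun φ x y z => by rw [hskew12, map_neg]
  refine ⟨fun ξ η γ => ?_, fun ξ η γ => ?_, fun ξ1 ξ2 ξ3 ξ4 ξ5 => ?_⟩
  · ext z
    simp only [LinearMap.neg_apply, dualBr_apply]
    linear_combination - skew γ (rMap k xs ys ξ) (rMap k xs ys η) z
      - skew ξ (rMap k xs ys η) (rMap k xs ys γ) z - skew η (rMap k xs ys γ) (rMap k xs ys ξ) z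
  · ext z
    simp only [LinearMap.neg_apply, dualBr_apply]
    linear_combination - skew γ (rMap k xs ys ξ) (rMap k xs ys η) z
      - skew ξ (rMap k xs ys η) (rMap k xs ys γ) z - skew η (rMap k xs ys γ) (rMap k xs ys ξ) z
  · ext z
    simp only [LinearMap.add_apply, dualBr_apply, hR]
    generalize rMap k xs ys ξ1 = a1, rMap k xs ys ξ2 = a2, rMap k xs ys ξ3 = a3,
      rMap k xs ys ξ4 = a4, rMap k xs ys ξ5 = a5
    have h1 := congrArg ξ1 (hS a2 a3 a4 a5 z)
    have h2 := congrArg ξ2 (hS a1 a3 a4 a5 z)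
    have h3 := congrArg ξ3 (hfi a1 a2 a4 a5 z)
    have h4 := congrArg ξ4 (hfi a1 a2 a5 a3 z)
    have h5 := congrArg ξ5 (hfi a1 a2 a3 a4 z)
    simp only [map_add, map_sub, map_neg] at h1 h2 h3 h4 h5
    have s0 := skew ξ2 (f a3 a4 a5) a1 z
    have s3 := skew ξ2 a3 a1 (f a4 a5 z)
    have s4 := skew ξ2 a4 a1 (f a5 a3 z)
    have s5 := skew ξ2 a5 a1 (f a3 a4 z)
    linear_combination -h1 + h2 - h3 - h4 - h5 - s0 - s3 - s4 - s5
end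

section
/- Let A be a finite-dimensional 3-Lie algebra over a field k of characteristic zero and let x_i, y_i (finite family) represent a skew-symmetric element r = Σ_i x_i⊗y_i ∈ A⊗A (σ12(r) = −r). Define [ξ,η,γ]* := ad*_{r(ξ),r(η)}γ + ad*_{r(η),r(γ)}ξ + ad*_{r(γ),r(ξ)}η for ξ,η,γ in A*. Then for all ξ,η,γ,κ in A*: ⟨κ, [r(ξ),r(η),r(γ)] − r([ξ,η,γ]*)⟩ equals the evaluation of the 4-tensor [[r,r,r]] on ξ⊗η⊗γ⊗κ, i.e. ⟨κ,[r(ξ),r(η),r(γ)] − r([ξ,η,γ]*)⟩ = Σ_{i,j,k} ( ξ([x_i,x_j,x_k])η(y_i)γ(y_j)κ(y_k) + ξ(x_i)η([y_i,x_j,x_k])γ(y_j)κ(y_k) + ξ(x_i)η(x_j)γ([y_i,y_j,x_k])κ(y_k) + ξ(x_i)η(x_j)γ(x_k)κ([y_i,y_j,y_k]) ). -/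
open TensorProduct

/-- Skew-symmetry of `∑ xᵢ ⊗ yᵢ` says that exchanging the two legs negates the induced map. -/
theorem rMap_swap_eq_neg {k A : Type*} [Field k] [AddCommGroup A] [Module k A]
    {ι : Type*} [Fintype ι] (xs ys : ι → A)
    (hskewr : (∑ i : ι, (ys i) ⊗ₜ[k] (xs i)) = - ∑ i : ι, (xs i) ⊗ₜ[k] (ys i))
    (ξ : Module.Dual k A) : rMap k ys xs ξ = - rMap k xs ys ξ := by
  have h := congrArg (fun t => TensorProduct.lid k A (LinearMap.rTensor A ξ t)) hskewr
  simpa [rMap] using h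

/-- A linear functional applied to a trilinear map evaluated at three values of `rMap`. -/
theorem dual_apply_rMap {k A : Type*} [Field k] [AddCommGroup A] [Module k A]
    (f : A →ₗ[k] A →ₗ[k] A →ₗ[k] A) {ι : Type*} [Fintype ι]
    (a a' b b' c c' : ι → A) (α β γ δ : Module.Dual k A) :
    δ (f (rMap k a a' α) (rMap k b b' β) (rMap k c c' γ)) =
      ∑ i : ι, ∑ j : ι, ∑ l : ι, α (a i) * β (b j) * γ (c l) * δ (f (a' i) (b' j) (c' l)) := by
  simp only [rMap, map_sum, map_smul, LinearMap.sum_apply, LinearMap.smul_apply, smul_eq_mul,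
    Finset.mul_sum]
  rw [Finset.sum_comm_cycle]
  refine Finset.sum_congr rfl fun i _ => ?_
  rw [Finset.sum_comm]
  refine Finset.sum_congr rfl fun j _ =>
    Finset.sum_congr rfl fun l _ => ?_
  ring

/-- Pairing with `rMap` moves the induced map to the other argument, with legs exchanged. -/
theorem dual_rMap_comm {k A : Type*} [Field k] [AddCommGroup A] [Module k A]
    {ι : Type*} [Fintype ι] (xs ys : ι → A) (φ κ : Module.Dual k A) :
    κ (rMap k xs ys φ) = φ (rMap k ys xs κ) := by
  simp [rMap, mul_comm]

/-- for skew-symmetric `r = Σᵢ xᵢ ⊗ yᵢ` in a finite-dimensional 3-Lie algebra,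
`⟨κ, [r(ξ),r(η),r(γ)] - r([ξ,η,γ]*)⟩` equals the evaluation of the 4-tensor `[[r,r,r]]`
on `ξ ⊗ η ⊗ γ ⊗ κ`. -/
theorem stmt8 {k A : Type*} [Field k] [CharZero k] [AddCommGroup A] [Module k A]
    [FiniteDimensional k A]
    (f : A →ₗ[k] A →ₗ[k] A →ₗ[k] A)
    (hskew12 : ∀ x y z : A, f x y z = - f y x z)
    (hskew23 : ∀ x y z : A, f x y z = - f x z y)
    (hfi : ∀ x1 x2 x3 x4 x5 : A,
      f x1 x2 (f x3 x4 x5) =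
        f (f x1 x2 x3) x4 x5 + f x3 (f x1 x2 x4) x5 + f x3 x4 (f x1 x2 x5))
    {ι : Type*} [Fintype ι] (xs ys : ι → A)
    (hskewr : (∑ i : ι, (ys i) ⊗ₜ[k] (xs i)) = - ∑ i : ι, (xs i) ⊗ₜ[k] (ys i)) :
    ∀ ξ η γ κ : Module.Dual k A,
      κ (f (rMap k xs ys ξ) (rMap k xs ys η) (rMap k xs ys γ)
          - rMap k xs ys (dualBr k f xs ys ξ η γ)) =
        ∑ i : ι, ∑ j : ι, ∑ l : ι,
          (ξ (f (xs i) (xs j) (xs l)) * η (ys i) * γ (ys j) * κ (ys l)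
          + ξ (xs i) * η (f (ys i) (xs j) (xs l)) * γ (ys j) * κ (ys l)
          + ξ (xs i) * η (xs j) * γ (f (ys i) (ys j) (xs l)) * κ (ys l)
          + ξ (xs i) * η (xs j) * γ (xs l) * κ (f (ys i) (ys j) (ys l))) := by
  intro ξ η γ κ
  have hr := rMap_swap_eq_neg xs ys hskewr
  have h₁ := dual_apply_rMap f ys xs ys xs ys xs η γ κ ξ
  have h₂ := dual_apply_rMap f xs ys ys xs ys xs ξ γ κ η
  have h₃ := dual_apply_rMap f xs ys xs ys ys xs ξ η κ γ
  have h₄ := dual_apply_rMap f xs ys xs ys xs ys ξ η γ κ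
  have hsum : (∑ i : ι, ∑ j : ι, ∑ l : ι,
      (ξ (f (xs i) (xs j) (xs l)) * η (ys i) * γ (ys j) * κ (ys l)
      + ξ (xs i) * η (f (ys i) (xs j) (xs l)) * γ (ys j) * κ (ys l)
      + ξ (xs i) * η (xs j) * γ (f (ys i) (ys j) (xs l)) * κ (ys l)
      + ξ (xs i) * η (xs j) * γ (xs l) * κ (f (ys i) (ys j) (ys l)))) =
      ξ (f (rMap k ys xs η) (rMap k ys xs γ) (rMap k ys xs κ))
      + η (f (rMap k xs ys ξ) (rMap k ys xs γ) (rMap k ys xs κ))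
      + γ (f (rMap k xs ys ξ) (rMap k xs ys η) (rMap k ys xs κ))
      + κ (f (rMap k xs ys ξ) (rMap k xs ys η) (rMap k xs ys γ)) := by
    rw [h₁, h₂, h₃, h₄]
    simp only [← Finset.sum_add_distrib]
    refine Finset.sum_congr rfl fun i _ => Finset.sum_congr rfl fun j _ =>
      Finset.sum_congr rfl fun l _ => ?_
    ring
  rw [hsum, map_sub, dual_rMap_comm xs ys (dualBr k f xs ys ξ η γ) κ]
  simp only [hr, dualBr, coad, map_neg, LinearMap.add_apply, LinearMap.neg_apply,
    LinearMap.dualMap_apply]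
  rw [hskew12 (rMap k xs ys γ) (rMap k xs ys ξ), map_neg]
  ring
end

section
/- Let A be a finite-dimensional 3-Lie algebra over a field k of characteristic zero and let r ∈ A⊗A be skew-symmetric such that the induced linear map r : A* → A is invertible (i.e. r is nondegenerate). Define the nondegenerate skew-symmetric bilinear form B on A by B(x,y) := ⟨r^{-1}(x), y⟩. Then r satisfies the 3-Lie classical Yang–Baxter equation [[r,r,r]] = 0 if and only if B([x,y,z],w) − B([x,y,w],z) + B([x,z,w],y) − B([y,z,w],x) = 0 for all x,y,z,w in A. -/
open TensorProduct

/-- Contraction of the last tensor factor against a linear form. -/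
noncomputable def contractLast {k A : Type*} [CommSemiring k] [AddCommMonoid A] [Module k A]
    (M : Type*) [AddCommMonoid M] [Module k M] (ξ : Module.Dual k A) : M ⊗[k] A →ₗ[k] M :=
  (TensorProduct.rid k M).toLinearMap ∘ₗ ξ.lTensor M

@[simp]
theorem contractLast_tmul {k A M : Type*} [CommSemiring k] [AddCommMonoid A] [Module k A]
    [AddCommMonoid M] [Module k M] (ξ : Module.Dual k A) (m : M) (a : A) :
    contractLast M ξ (m ⊗ₜ a) = ξ a • m := by
  simp [contractLast]

theorem eq_zero_iff_forall_contractLast_eq_zero {k A M : Type*} [Field k] [AddCommGroup A]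
    [Module k A] [AddCommGroup M] [Module k M] (t : M ⊗[k] A) :
    t = 0 ↔ ∀ ξ : Module.Dual k A, contractLast M ξ t = 0 := by
  classical
  refine ⟨fun h ξ => by simp [h], fun h => ?_⟩
  let b := Module.Basis.ofVectorSpace k A
  refine (TensorProduct.equivFinsuppOfBasisRight (M := M) b).injective ?_
  ext i
  rw [TensorProduct.equivFinsuppOfBasisRight_apply, map_zero, Finsupp.zero_apply]
  exact h (b.coord i)

theorem trilinear_sum_smul {k A N ι : Type*} [CommSemiring k] [AddCommMonoid A] [Module k A]
    [AddCommMonoid N] [Module k N] [Fintype ι] (f : A →ₗ[k] A →ₗ[k] A →ₗ[k] N)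
    (a b c : ι → k) (u v w : ι → A) :
    f (∑ i, a i • u i) (∑ j, b j • v j) (∑ l, c l • w l) =
      ∑ i, ∑ j, ∑ l, (a i * (b j * c l)) • f (u i) (v j) (w l) := by
  rw [map_sum f, LinearMap.sum_apply, LinearMap.sum_apply]
  refine Finset.sum_congr rfl fun i _ => ?_
  rw [map_sum (f _), LinearMap.sum_apply]
  refine Finset.sum_congr rfl fun j _ => ?_
  rw [map_sum]
  refine Finset.sum_congr rfl fun l _ => ?_
  simp [smul_smul, mul_comm, mul_left_comm]

theorem sum_smul_eq_neg_rMap {k A ι : Type*} [Field k] [AddCommGroup A] [Module k A] [Fintype ι]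
    {xs ys : ι → A}
    (hskewr : (∑ i : ι, (ys i) ⊗ₜ[k] (xs i)) = - ∑ i : ι, (xs i) ⊗ₜ[k] (ys i))
    (ξ : Module.Dual k A) : ∑ i, ξ (ys i) • xs i = -rMap k xs ys ξ := by
  have h := congrArg (contractLast A ξ) hskewr
  simp only [map_sum, map_neg, contractLast_tmul] at h
  rw [rMap, h, neg_neg]

/-- The contraction of `[[r,r,r]]` against four linear forms. -/
theorem contract_yangBaxter {k A ι : Type*} [Field k] [AddCommGroup A] [Module k A] [Fintype ι]
    (f : A →ₗ[k] A →ₗ[k] A →ₗ[k] A) {xs ys : ι → A}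
    (hskewr : (∑ i : ι, (ys i) ⊗ₜ[k] (xs i)) = - ∑ i : ι, (xs i) ⊗ₜ[k] (ys i))
    (α β γ δ : Module.Dual k A) :
    α (contractLast A β (contractLast _ γ (contractLast _ δ
      (∑ i : ι, ∑ j : ι, ∑ l : ι,
        ((((f (xs i) (xs j) (xs l)) ⊗ₜ[k] (ys i)) ⊗ₜ[k] (ys j)) ⊗ₜ[k] (ys l)
        + (((xs i) ⊗ₜ[k] (f (ys i) (xs j) (xs l))) ⊗ₜ[k] (ys j)) ⊗ₜ[k] (ys l)
        + (((xs i) ⊗ₜ[k] (xs j)) ⊗ₜ[k] (f (ys i) (ys j) (xs l))) ⊗ₜ[k] (ys l)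
        + (((xs i) ⊗ₜ[k] (xs j)) ⊗ₜ[k] (xs l)) ⊗ₜ[k] (f (ys i) (ys j) (ys l))))))) =
      -α (f (rMap k xs ys β) (rMap k xs ys γ) (rMap k xs ys δ))
      + β (f (rMap k xs ys α) (rMap k xs ys γ) (rMap k xs ys δ))
      - γ (f (rMap k xs ys α) (rMap k xs ys β) (rMap k xs ys δ))
      + δ (f (rMap k xs ys α) (rMap k xs ys β) (rMap k xs ys γ)) := by
  have h1 : -α (f (rMap k xs ys β) (rMap k xs ys γ) (rMap k xs ys δ)) =
      α (f (∑ i, β (ys i) • xs i) (∑ i, γ (ys i) • xs i) (∑ i, δ (ys i) • xs i)) := by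
    simp [sum_smul_eq_neg_rMap hskewr]
  have h2 : β (f (rMap k xs ys α) (rMap k xs ys γ) (rMap k xs ys δ)) =
      β (f (∑ i, α (xs i) • ys i) (∑ i, γ (ys i) • xs i) (∑ i, δ (ys i) • xs i)) := by
    rw [sum_smul_eq_neg_rMap hskewr, sum_smul_eq_neg_rMap hskewr]
    simp only [map_neg, LinearMap.neg_apply, neg_neg]
    rfl
  have h3 : -γ (f (rMap k xs ys α) (rMap k xs ys β) (rMap k xs ys δ)) =
      γ (f (∑ i, α (xs i) • ys i) (∑ i, β (xs i) • ys i) (∑ i, δ (ys i) • xs i)) := by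
    rw [sum_smul_eq_neg_rMap hskewr, map_neg, map_neg, rMap, rMap]
  rw [sub_eq_add_neg, h1, h2, h3]
  simp only [rMap, trilinear_sum_smul]
  simp only [map_sum, map_add, contractLast_tmul, map_smul,
    smul_eq_mul, ← Finset.sum_add_distrib]
  refine Finset.sum_congr rfl fun i _ => Finset.sum_congr rfl fun j _ =>
    Finset.sum_congr rfl fun l _ => ?_
  ring

/-- for a skew-symmetric nondegenerate `r = Σᵢ xᵢ ⊗ yᵢ` in a finite-dimensional
3-Lie algebra, with inverse `s = r⁻¹ : A → A*` and bilinear form `B(x,y) = ⟨r⁻¹(x), y⟩`,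
`r` solves the 3-Lie classical Yang–Baxter equation iff
`B([x,y,z],w) - B([x,y,w],z) + B([x,z,w],y) - B([y,z,w],x) = 0` for all `x,y,z,w`. -/
theorem stmt9 {k A : Type*} [Field k] [CharZero k] [AddCommGroup A] [Module k A]
    [FiniteDimensional k A]
    (f : A →ₗ[k] A →ₗ[k] A →ₗ[k] A)
    (hskew12 : ∀ x y z : A, f x y z = - f y x z)
    (hskew23 : ∀ x y z : A, f x y z = - f x z y)
    (hfi : ∀ x1 x2 x3 x4 x5 : A,
      f x1 x2 (f x3 x4 x5) =
        f (f x1 x2 x3) x4 x5 + f x3 (f x1 x2 x4) x5 + f x3 x4 (f x1 x2 x5))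
    {ι : Type*} [Fintype ι] (xs ys : ι → A)
    (hskewr : (∑ i : ι, (ys i) ⊗ₜ[k] (xs i)) = - ∑ i : ι, (xs i) ⊗ₜ[k] (ys i))
    (s : A →ₗ[k] Module.Dual k A)
    (hsr : ∀ ξ : Module.Dual k A, s (rMap k xs ys ξ) = ξ)
    (hrs : ∀ x : A, rMap k xs ys (s x) = x) :
    ((∑ i : ι, ∑ j : ι, ∑ l : ι,
        ((((f (xs i) (xs j) (xs l)) ⊗ₜ[k] (ys i)) ⊗ₜ[k] (ys j)) ⊗ₜ[k] (ys l)
        + (((xs i) ⊗ₜ[k] (f (ys i) (xs j) (xs l))) ⊗ₜ[k] (ys j)) ⊗ₜ[k] (ys l)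
        + (((xs i) ⊗ₜ[k] (xs j)) ⊗ₜ[k] (f (ys i) (ys j) (xs l))) ⊗ₜ[k] (ys l)
        + (((xs i) ⊗ₜ[k] (xs j)) ⊗ₜ[k] (xs l)) ⊗ₜ[k] (f (ys i) (ys j) (ys l)))) =
      (0 : ((A ⊗[k] A) ⊗[k] A) ⊗[k] A)) ↔
    (∀ x y z w : A,
      s (f x y z) w - s (f x y w) z + s (f x z w) y - s (f y z w) x = 0) := by
  have skew : ∀ x y : A, s x y = -s y x := by
    intro x y
    have h := congrArg (s x) (sum_smul_eq_neg_rMap hskewr (s y))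
    rw [hrs, map_neg] at h
    have h' := congrArg (s y) (hrs x)
    simp only [rMap, map_sum, map_smul, smul_eq_mul] at h h'
    rw [← h', ← neg_eq_iff_eq_neg, ← h]
    exact Finset.sum_congr rfl fun i _ => mul_comm _ _
  have pairing (x y z w : A) := contract_yangBaxter f hskewr (s x) (s y) (s z) (s w)
  simp only [hrs] at pairing
  constructor
  · intro h x y z w
    have e := pairing x y z w
    rw [h] at e
    simp only [map_zero] at e
    rw [skew _ w, skew _ z, skew _ y, skew _ x]
    linear_combination e
  · intro h
    rw [eq_zero_iff_forall_contractLast_eq_zero]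
    intro δ
    rw [eq_zero_iff_forall_contractLast_eq_zero]
    intro γ
    rw [eq_zero_iff_forall_contractLast_eq_zero]
    intro β
    rw [← Module.forall_dual_apply_eq_zero_iff k]
    intro α
    rw [← hsr α, ← hsr β, ← hsr γ, ← hsr δ, pairing]
    have e := h (rMap k xs ys α) (rMap k xs ys β) (rMap k xs ys γ) (rMap k xs ys δ)
    rw [skew (f _ _ _), skew (f _ _ _) (rMap k xs ys γ), skew (f _ _ _) (rMap k xs ys β),
      skew (f _ _ _) (rMap k xs ys α)] at e
    linear_combination -e
end

section
/- Let A be a 3-Lie algebra over a field of characteristic zero, (V,ρ) a representation of A, and T : V → A an O-operator associated to (V,ρ). Then the trilinear map on V defined by {u,v,w} := ρ(Tu,Tv)w makes V a 3-pre-Lie algebra. -/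
/-- if `T : V → A` is an O-operator associated to a representation `(V, ρ)`
of a 3-Lie algebra `A`, then `{u,v,w} := ρ(Tu,Tv)w` makes `V` a 3-pre-Lie algebra. -/
theorem stmt14 {k A V : Type*} [Field k] [CharZero k] [AddCommGroup A] [Module k A]
    [AddCommGroup V] [Module k V]
    (f : A →ₗ[k] A →ₗ[k] A →ₗ[k] A)
    (hskew12 : ∀ x y z : A, f x y z = - f y x z)
    (hskew23 : ∀ x y z : A, f x y z = - f x z y)
    (hfi : ∀ x1 x2 x3 x4 x5 : A,
      f x1 x2 (f x3 x4 x5) =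
        f (f x1 x2 x3) x4 x5 + f x3 (f x1 x2 x4) x5 + f x3 x4 (f x1 x2 x5))
    (ρ : A →ₗ[k] A →ₗ[k] Module.End k V)
    (hρskew : ∀ x y : A, ρ x y = - ρ y x)
    (hrep1 : ∀ x1 x2 x3 x4 : A,
      ρ x1 x2 * ρ x3 x4 - ρ x3 x4 * ρ x1 x2 = ρ (f x1 x2 x3) x4 - ρ (f x1 x2 x4) x3)
    (hrep2 : ∀ x1 x2 x3 x4 : A,
      ρ (f x1 x2 x3) x4 = ρ x1 x2 * ρ x3 x4 + ρ x2 x3 * ρ x1 x4 + ρ x3 x1 * ρ x2 x4)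
    (T : V →ₗ[k] A)
    (hT : ∀ u v w : V,
      f (T u) (T v) (T w) =
        T (ρ (T u) (T v) w + ρ (T v) (T w) u + ρ (T w) (T u) v)) :
    -- `{u,v,w} := ρ(Tu,Tv)w` is a 3-pre-Lie multiplication on `V`:
    (∀ u v w : V, ρ (T u) (T v) w = - ρ (T v) (T u) w) ∧
    (∀ v1 v2 v3 v4 v5 : V,
      ρ (T v1) (T v2) (ρ (T v3) (T v4) v5) =
        ρ (T (ρ (T v1) (T v2) v3 + ρ (T v2) (T v3) v1 + ρ (T v3) (T v1) v2)) (T v4) v5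
        + ρ (T v3) (T (ρ (T v1) (T v2) v4 + ρ (T v2) (T v4) v1 + ρ (T v4) (T v1) v2)) v5
        + ρ (T v3) (T v4) (ρ (T v1) (T v2) v5)) ∧
    (∀ v1 v2 v3 v4 v5 : V,
      ρ (T (ρ (T v1) (T v2) v3 + ρ (T v2) (T v3) v1 + ρ (T v3) (T v1) v2)) (T v4) v5 =
        ρ (T v1) (T v2) (ρ (T v3) (T v4) v5)
        + ρ (T v2) (T v3) (ρ (T v1) (T v4) v5)
        + ρ (T v3) (T v1) (ρ (T v2) (T v4) v5)) := by
  simp only [← hT]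
  refine ⟨fun u v w => ?_, fun v1 v2 v3 v4 v5 => ?_, fun v1 v2 v3 v4 v5 => ?_⟩
  · rw [hρskew, LinearMap.neg_apply]
  · have h := LinearMap.congr_fun (hrep1 (T v1) (T v2) (T v3) (T v4)) v5
    simp only [LinearMap.sub_apply, Module.End.mul_apply] at h
    rw [hρskew (T v3) (f _ _ _), LinearMap.neg_apply, ← sub_eq_add_neg, ← h, sub_add_cancel]
  · simpa using LinearMap.congr_fun (hrep2 (T v1) (T v2) (T v3) (T v4)) v5
end

section
/- Let (A,[·,·,·]) be a 3-Lie algebra over a field of characteristic zero. Then there exists a compatible 3-pre-Lie algebra structure on A (i.e. a 3-pre-Lie multiplication {·,·,·} on A with {x,y,z} + {y,z,x} + {z,x,y} = [x,y,z] for all x,y,z) if and only if there exists a representation (V,ρ) of A and an invertible O-operator T : V → A associated to (V,ρ). -/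
universe u

/-- A bundled representation of the 3-Lie algebra `(A, f)`. -/
structure ThreeLieRepOn (k : Type u) (A : Type u) [Field k] [AddCommGroup A] [Module k A]
    (f : A →ₗ[k] A →ₗ[k] A →ₗ[k] A) : Type (u + 1) where
  V : Type u
  [addCommGroup : AddCommGroup V]
  [module : @Module k V _ addCommGroup.toAddCommMonoid]
  ρ : A →ₗ[k] A →ₗ[k] @Module.End k V _ addCommGroup.toAddCommMonoid module
  skew : ∀ x y : A, ρ x y = - ρ y x
  rep1 : ∀ x1 x2 x3 x4 : A,
    ρ x1 x2 * ρ x3 x4 - ρ x3 x4 * ρ x1 x2 = ρ (f x1 x2 x3) x4 - ρ (f x1 x2 x4) x3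
  rep2 : ∀ x1 x2 x3 x4 : A,
    ρ (f x1 x2 x3) x4 = ρ x1 x2 * ρ x3 x4 + ρ x2 x3 * ρ x1 x4 + ρ x3 x1 * ρ x2 x4

attribute [instance] ThreeLieRepOn.addCommGroup ThreeLieRepOn.module

/-- a 3-Lie algebra `A` admits a compatible 3-pre-Lie algebra structure iff
there exist a representation `(V, ρ)` of `A` and an invertible O-operator `T : V → A`
associated to it. -/
theorem stmt15 {k A : Type u} [Field k] [CharZero k] [AddCommGroup A] [Module k A]
    (f : A →ₗ[k] A →ₗ[k] A →ₗ[k] A)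
    (hskew12 : ∀ x y z : A, f x y z = - f y x z)
    (hskew23 : ∀ x y z : A, f x y z = - f x z y)
    (hfi : ∀ x1 x2 x3 x4 x5 : A,
      f x1 x2 (f x3 x4 x5) =
        f (f x1 x2 x3) x4 x5 + f x3 (f x1 x2 x4) x5 + f x3 x4 (f x1 x2 x5)) :
    (∃ p : A →ₗ[k] A →ₗ[k] A →ₗ[k] A,
      (∀ x y z : A, p x y z = - p y x z) ∧
      (∀ x1 x2 x3 x4 x5 : A,
        p x1 x2 (p x3 x4 x5) =
          p (p x1 x2 x3 + p x2 x3 x1 + p x3 x1 x2) x4 x5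
          + p x3 (p x1 x2 x4 + p x2 x4 x1 + p x4 x1 x2) x5
          + p x3 x4 (p x1 x2 x5)) ∧
      (∀ x1 x2 x3 x4 x5 : A,
        p (p x1 x2 x3 + p x2 x3 x1 + p x3 x1 x2) x4 x5 =
          p x1 x2 (p x3 x4 x5) + p x2 x3 (p x1 x4 x5) + p x3 x1 (p x2 x4 x5)) ∧
      (∀ x y z : A, p x y z + p y z x + p z x y = f x y z)) ↔
    (∃ (R : ThreeLieRepOn k A f) (T : R.V →ₗ[k] A),
      Function.Bijective T ∧
      (∀ u v w : R.V,
        f (T u) (T v) (T w) =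
          T (R.ρ (T u) (T v) w + R.ρ (T v) (T w) u + R.ρ (T w) (T u) v))) := by
  constructor
  · rintro ⟨p, hskew, hp1, hp2, hpf⟩
    simp only [hpf] at hp1 hp2
    let R : ThreeLieRepOn k A f :=
      { V := A
        ρ := p
        skew := fun x y => by
          ext z
          exact hskew x y z
        rep1 := fun x1 x2 x3 x4 => by
          ext z
          have h := hp1 x1 x2 x3 x4 z
          rw [hskew x3 (f x1 x2 x4) z] at h
          simp only [LinearMap.sub_apply, Module.End.mul_apply, h]
          abel
        rep2 := fun x1 x2 x3 x4 => by
          ext z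
          exact hp2 x1 x2 x3 x4 z }
    exact ⟨R, LinearMap.id, Function.bijective_id, fun u v w => (hpf u v w).symm⟩
  · rintro ⟨R, T, hT, hO⟩
    let e : R.V ≃ₗ[k] A := LinearEquiv.ofBijective T hT
    let p : A →ₗ[k] A →ₗ[k] A →ₗ[k] A := R.ρ.compr₂ e.conj.toLinearMap
    have hp : ∀ x y z, p x y z = e (R.ρ x y (e.symm z)) := fun _ _ _ => rfl
    have hpf : ∀ x y z, p x y z + p y z x + p z x y = f x y z := fun x y z => by
      have h : f (e (e.symm x)) (e (e.symm y)) (e (e.symm z)) = _ :=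
        hO (e.symm x) (e.symm y) (e.symm z)
      change _ = e (R.ρ (e (e.symm x)) (e (e.symm y)) (e.symm z)
        + R.ρ (e (e.symm y)) (e (e.symm z)) (e.symm x)
        + R.ρ (e (e.symm z)) (e (e.symm x)) (e.symm y)) at h
      simp only [LinearEquiv.apply_symm_apply, map_add] at h
      exact h.symm
    have hskew : ∀ x y z, p x y z = - p y x z := fun x y z => by
      rw [hp, hp, R.skew x y, LinearMap.neg_apply, map_neg]
    refine ⟨p, hskew, fun x1 x2 x3 x4 x5 => ?_, fun x1 x2 x3 x4 x5 => ?_, hpf⟩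
    · have h := congrArg e (LinearMap.congr_fun (R.rep1 x1 x2 x3 x4) (e.symm x5))
      simp only [LinearMap.sub_apply, Module.End.mul_apply, map_sub] at h
      rw [hpf, hpf, hskew x3 (f x1 x2 x4)]
      simp only [hp, LinearEquiv.symm_apply_apply]
      rw [← sub_eq_add_neg, ← h, sub_add_cancel]
    · rw [hpf]
      simp only [hp, LinearEquiv.symm_apply_apply, R.rep2, LinearMap.add_apply,
        Module.End.mul_apply, map_add]
end

section
/- Let (A,[·,·,·]) be a finite-dimensional 3-Lie algebra over a field of characteristic zero, and let B be a nondegenerate skew-symmetric bilinear form on A satisfying B([x,y,z],w) − B([x,y,w],z) + B([x,z,w],y) − B([y,z,w],x) = 0 for all x,y,z,w in A. Then the trilinear map {·,·,·} on A uniquely determined by B({x,y,z},w) = −B(z,[x,y,w]) for all x,y,z,w is a compatible 3-pre-Lie algebra structure on A, i.e. it is a 3-pre-Lie multiplication and {x,y,z} + {y,z,x} + {z,x,y} = [x,y,z] for all x,y,z in A. -/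
/-- The fundamental identity of a 3-Lie algebra, with every inner bracket in the first slot. -/
theorem bracket_bracket_eq_cyclic_sum {A : Type*} [AddCommGroup A] (f : A → A → A → A)
    (hskew12 : ∀ x y z : A, f x y z = - f y x z)
    (hskew23 : ∀ x y z : A, f x y z = - f x z y)
    (hfi : ∀ x1 x2 x3 x4 x5 : A,
      f x1 x2 (f x3 x4 x5) =
        f (f x1 x2 x3) x4 x5 + f x3 (f x1 x2 x4) x5 + f x3 x4 (f x1 x2 x5))
    (a b x y z : A) :
    f (f x y z) a b = f (f a b x) y z + f (f a b y) z x + f (f a b z) x y := by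
  have hcyc : ∀ u v w : A, f u v w = f w u v := fun u v w => by
    rw [hskew23 u v w, hskew12 u w v, neg_neg]
  rw [← hcyc a b (f x y z), hfi, hcyc x (f a b y) z, hcyc z x (f a b y),
    hcyc x y (f a b z)]

/-- In a 3-Lie algebra over a field of characteristic zero,
`-[[x, y, z], a, b]` is the cyclic sum over `x, y, z` of `[z, a, [x, y, b]]`. -/
theorem neg_bracket_bracket_eq_cyclic_sum {k A : Type*} [Field k] [CharZero k]
    [AddCommGroup A] [Module k A]
    (f : A →ₗ[k] A →ₗ[k] A →ₗ[k] A)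
    (hskew12 : ∀ x y z : A, f x y z = - f y x z)
    (hskew23 : ∀ x y z : A, f x y z = - f x z y)
    (hfi : ∀ x1 x2 x3 x4 x5 : A,
      f x1 x2 (f x3 x4 x5) =
        f (f x1 x2 x3) x4 x5 + f x3 (f x1 x2 x4) x5 + f x3 x4 (f x1 x2 x5))
    (x y z a b : A) :
    - f (f x y z) a b = f z a (f x y b) + f x a (f y z b) + f y a (f z x b) := by
  have hcyc : ∀ u v w : A, f u v w = f w u v := fun u v w => by
    rw [hskew23 u v w, hskew12 u w v, neg_neg]
  have hG := bracket_bracket_eq_cyclic_sum (fun u v w => f u v w) hskew12 hskew23 hfi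
  have hpair : ∀ u v w : A,
      f (f a b w) u v = f (f u v w) a b - f (f u v a) w b + f (f u v b) w a := fun u v w => by
    have h := hG u v w a b
    rw [hcyc w a b, hcyc b w a] at h
    rw [hcyc a b w, hcyc w a b, hcyc b w a, h, hskew23 (f u v a) b w, sub_eq_add_neg]
  have hmixed : ∀ u v w : A,
      f (f v w b) u a = - f (f u v a) w b - f (f w u a) v b + f (f a b u) v w := fun u v w => by
    have h := hG u a v w b
    rw [h, hskew23 u a v, hcyc u a w, hskew23 (f w u a) b v, hcyc u a b, hcyc b u a]
    simp only [map_neg, LinearMap.neg_apply, sub_eq_add_neg]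
  rw [hcyc z a, hcyc x a, hcyc y a]
  have h0 := hG a b x y z
  have hy := hpair y z x
  have hz := hpair z x y
  rw [hcyc y z x] at hy
  rw [← hcyc x y z] at hz
  linear_combination (norm := module) h0 + (2 / 3 : k) • (hpair x y z + hy + hz)
    - (1 / 3 : k) • (hmixed x y z + hmixed y z x + hmixed z x y)

/-- on a finite-dimensional 3-Lie algebra with a nondegenerate skew-symmetric
bilinear form `B` satisfying `B([x,y,z],w) - B([x,y,w],z) + B([x,z,w],y) - B([y,z,w],x) = 0`,
the trilinear map determined by `B({x,y,z},w) = -B(z,[x,y,w])` is a compatible 3-pre-Lie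
algebra structure. -/
theorem stmt16 {k A : Type*} [Field k] [CharZero k] [AddCommGroup A] [Module k A]
    [FiniteDimensional k A]
    (f : A →ₗ[k] A →ₗ[k] A →ₗ[k] A)
    (hskew12 : ∀ x y z : A, f x y z = - f y x z)
    (hskew23 : ∀ x y z : A, f x y z = - f x z y)
    (hfi : ∀ x1 x2 x3 x4 x5 : A,
      f x1 x2 (f x3 x4 x5) =
        f (f x1 x2 x3) x4 x5 + f x3 (f x1 x2 x4) x5 + f x3 x4 (f x1 x2 x5))
    (B : A →ₗ[k] A →ₗ[k] k)
    (hBskew : ∀ x y : A, B x y = - B y x)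
    (hBnondeg : Function.Bijective (B : A →ₗ[k] Module.Dual k A))
    (hBinv : ∀ x y z w : A,
      B (f x y z) w - B (f x y w) z + B (f x z w) y - B (f y z w) x = 0)
    (p : A →ₗ[k] A →ₗ[k] A →ₗ[k] A)
    (hp : ∀ x y z w : A, B (p x y z) w = - B z (f x y w)) :
    (∀ x y z : A, p x y z = - p y x z) ∧
    (∀ x1 x2 x3 x4 x5 : A,
      p x1 x2 (p x3 x4 x5) =
        p (p x1 x2 x3 + p x2 x3 x1 + p x3 x1 x2) x4 x5
        + p x3 (p x1 x2 x4 + p x2 x4 x1 + p x4 x1 x2) x5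
        + p x3 x4 (p x1 x2 x5)) ∧
    (∀ x1 x2 x3 x4 x5 : A,
      p (p x1 x2 x3 + p x2 x3 x1 + p x3 x1 x2) x4 x5 =
        p x1 x2 (p x3 x4 x5) + p x2 x3 (p x1 x4 x5) + p x3 x1 (p x2 x4 x5)) ∧
    (∀ x y z : A, p x y z + p y z x + p z x y = f x y z) := by
  have hcyc : ∀ u v w : A, f u v w = f w u v := fun u v w => by
    rw [hskew23 u v w, hskew12 u w v, neg_neg]
  have hext : ∀ u v : A, (∀ w, B u w = B v w) → u = v := fun u v h =>
    hBnondeg.injective (LinearMap.ext h)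
  have hcompat : ∀ x y z : A, p x y z + p y z x + p z x y = f x y z := fun x y z =>
    hext _ _ fun w => by
      simp only [map_add, LinearMap.add_apply, hp]
      have h := hBinv x y z w
      rw [hskew12 x z w, map_neg, LinearMap.neg_apply] at h
      linear_combination -h - hBskew z (f x y w) - hBskew x (f y z w) - hBskew y (f z x w)
  have hpp : ∀ x1 x2 x3 x4 x5 w : A,
      B (p x1 x2 (p x3 x4 x5)) w = B x5 (f x3 x4 (f x1 x2 w)) := fun x1 x2 x3 x4 x5 w => by
    rw [hp, hp, neg_neg]
  refine ⟨fun x y z => hext _ _ fun w => ?_, fun x1 x2 x3 x4 x5 => hext _ _ fun w => ?_,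
    fun x1 x2 x3 x4 x5 => hext _ _ fun w => ?_, hcompat⟩
  · rw [map_neg, LinearMap.neg_apply, hp, hp, hskew12 x y w, map_neg]
  · rw [hcompat, hcompat]
    simp only [map_add, LinearMap.add_apply, hpp]
    rw [hp, hp, hfi x1 x2 x3 x4 w]
    simp only [map_add]
    ring
  · rw [hcompat]
    simp only [map_add, LinearMap.add_apply, hpp]
    rw [hp, ← map_neg, neg_bracket_bracket_eq_cyclic_sum f hskew12 hskew23 hfi]
    simp only [map_add]
end

section
/- Let (A,[·,·,·]) and (A',[·,·,·]') be 3-Lie algebras over a field of characteristic zero, and let ρ : A × A → End(A') and μ : A' × A' → End(A) be bilinear maps with ρ(x,y) = −ρ(y,x) and μ(a,b) = −μ(b,a), such that (A',ρ) is a representation of A, (A,μ) is a representation of A', and for all x1,...,x5 in A and a1,...,a5 in A' the following six compatibility conditions hold: (1) μ(a4,a5)[x1,x2,x3] = [μ(a4,a5)x1,x2,x3] + [x1,μ(a4,a5)x2,x3] + [x1,x2,μ(a4,a5)x3]; (2) −μ(ρ(x1,x2)a3,a5)x4 = −μ(ρ(x1,x4)a5,a3)x2 + μ(ρ(x2,x4)a5,a3)x1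 − [x1,x2,μ(a3,a5)x4]; (3) [μ(a2,a3)x1,x4,x5] = μ(a2,a3)[x1,x4,x5] + μ(ρ(x4,x5)a2,a3)x1 + μ(a2,ρ(x4,x5)a3)x1; (4) ρ(x4,x5)[a1,a2,a3]' = [ρ(x4,x5)a1,a2,a3]' + [a1,ρ(x4,x5)a2,a3]' + [a1,a2,ρ(x4,x5)a3]'; (5) −ρ(μ(a1,a2)x3,x5)a4 = −ρ(μ(a1,a4)x5,x3)a2 + ρ(μ(a2,a4)x5,x3)a1 − [a1,a2,ρ(x3,x5)a4]'; (6) [ρ(x2,x3)a1,a4,a5]' = ρ(x2,x3)[a1,a4,a5]' + ρ(μ(a4,a5)x2,x3)a1 + ρ(x2,μ(a4,a5)x3)a1. Then the bracket on A ⊕ A' defined by [x1+a1, x2+a2, x3+a3] = [x1,x2,x3] + μ(a1,a2)x3 + μ(a3,a1)x2 + μ(a2,a3)x1 + [a1,a2,a3]' + ρ(x1,x2)a3 + ρ(x3,x1)a2 + ρ(x2,x3)a1 is a 3-Lie algebra structure on A ⊕ A'. -/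
/-- The `A`-component of the bracket of `x + a`, `y + b`, `z + c` in `A ⊕ A'`. -/
def sumBracket {k A A' : Type*} [Field k]
    [AddCommGroup A] [Module k A] [AddCommGroup A'] [Module k A']
    (f : A →ₗ[k] A →ₗ[k] A →ₗ[k] A) (μ : A' →ₗ[k] A' →ₗ[k] Module.End k A)
    (x y z : A) (a b c : A') : A :=
  f x y z + μ a b z + μ c a y + μ b c x

section sumBracket

variable {k A A' : Type*} [Field k]
  [AddCommGroup A] [Module k A] [AddCommGroup A'] [Module k A']
  {f : A →ₗ[k] A →ₗ[k] A →ₗ[k] A} {μ : A' →ₗ[k] A' →ₗ[k] Module.End k A}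

theorem sumBracket_swap_left (hf : ∀ x y z : A, f x y z = - f y x z)
    (hμ : ∀ a b : A', μ a b = - μ b a) (x y z : A) (a b c : A') :
    sumBracket f μ x y z a b c = - sumBracket f μ y x z b a c := by
  simp only [sumBracket, hf x y z, hμ a b, hμ c a, hμ b c, LinearMap.neg_apply]
  abel

theorem sumBracket_swap_right (hf : ∀ x y z : A, f x y z = - f x z y)
    (hμ : ∀ a b : A', μ a b = - μ b a) (x y z : A) (a b c : A') :
    sumBracket f μ x y z a b c = - sumBracket f μ x z y a c b := by
  simp only [sumBracket, hf x y z, hμ a b, hμ c a, hμ b c, LinearMap.neg_apply]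
  abel

/-- The `A`-component of the Fundamental Identity on `A ⊕ A'`. -/
theorem sumBracket_fundamental_identity
    (hfskew12 : ∀ x y z : A, f x y z = - f y x z)
    (hfskew23 : ∀ x y z : A, f x y z = - f x z y)
    (hffi : ∀ x1 x2 x3 x4 x5 : A,
      f x1 x2 (f x3 x4 x5) =
        f (f x1 x2 x3) x4 x5 + f x3 (f x1 x2 x4) x5 + f x3 x4 (f x1 x2 x5))
    (g : A' →ₗ[k] A' →ₗ[k] A' →ₗ[k] A')
    (ρ : A →ₗ[k] A →ₗ[k] Module.End k A')
    (hρskew : ∀ x y : A, ρ x y = - ρ y x)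
    (hμskew : ∀ a b : A', μ a b = - μ b a)
    (hμrep1 : ∀ a1 a2 a3 a4 : A',
      μ a1 a2 * μ a3 a4 - μ a3 a4 * μ a1 a2 = μ (g a1 a2 a3) a4 - μ (g a1 a2 a4) a3)
    (hμrep2 : ∀ a1 a2 a3 a4 : A',
      μ (g a1 a2 a3) a4 = μ a1 a2 * μ a3 a4 + μ a2 a3 * μ a1 a4 + μ a3 a1 * μ a2 a4)
    (hc1 : ∀ (a4 a5 : A') (x1 x2 x3 : A),
      μ a4 a5 (f x1 x2 x3) =
        f (μ a4 a5 x1) x2 x3 + f x1 (μ a4 a5 x2) x3 + f x1 x2 (μ a4 a5 x3))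
    (hc2 : ∀ (x1 x2 x4 : A) (a3 a5 : A'),
      - μ (ρ x1 x2 a3) a5 x4 =
        - μ (ρ x1 x4 a5) a3 x2 + μ (ρ x2 x4 a5) a3 x1 - f x1 x2 (μ a3 a5 x4))
    (hc3 : ∀ (a2 a3 : A') (x1 x4 x5 : A),
      f (μ a2 a3 x1) x4 x5 =
        μ a2 a3 (f x1 x4 x5) + μ (ρ x4 x5 a2) a3 x1 + μ a2 (ρ x4 x5 a3) x1)
    (x1 x2 x3 x4 x5 : A) (a1 a2 a3 a4 a5 : A') :
    sumBracket f μ x1 x2 (sumBracket f μ x3 x4 x5 a3 a4 a5)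
        a1 a2 (sumBracket g ρ a3 a4 a5 x3 x4 x5) =
      sumBracket f μ (sumBracket f μ x1 x2 x3 a1 a2 a3) x4 x5
          (sumBracket g ρ a1 a2 a3 x1 x2 x3) a4 a5 +
        sumBracket f μ x3 (sumBracket f μ x1 x2 x4 a1 a2 a4) x5
          a3 (sumBracket g ρ a1 a2 a4 x1 x2 x4) a5 +
        sumBracket f μ x3 x4 (sumBracket f μ x1 x2 x5 a1 a2 a5)
          a3 a4 (sumBracket g ρ a1 a2 a5 x1 x2 x5) := by
  have hfcyc (x y z : A) : f x y z = f y z x := by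
    rw [hfskew12 x y z, hfskew23 y x z, neg_neg]
  -- the first two arguments lie in `A`
  have inner (x y z : A) (a b : A') :
      f x y (μ a b z) = μ (ρ x y a) b z + μ a (ρ x y b) z + μ a b (f x y z) := by
    rw [← hfcyc, hc3, hfcyc z x y]
    abel
  -- one of the first two arguments lies in `A`, the other one in `A'`
  have mixed (a : A') (x : A) (b : A') (y z : A) :
      μ (ρ y z b) a x = f (μ b a x) y z + μ b (ρ x y a) z + μ (ρ x z a) b y := by
    have h := hc2 y z x b a
    rw [← hfcyc] at h
    simp only [hρskew y x, hρskew z x, hμskew b (ρ x y a), map_neg, LinearMap.neg_apply] at h ⊢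
    linear_combination (norm := abel) -h
  have mixed' (x : A) (a b : A') (y z : A) :
      μ a (ρ y z b) x = f (μ a b x) y z + μ b (ρ y x a) z + μ (ρ z x a) b y := by
    have h := mixed a x b y z
    simp only [hρskew x y, hρskew x z, hμskew b a, hμskew (ρ y z b) a, map_neg,
      LinearMap.neg_apply] at h
    linear_combination (norm := abel) -h
  -- the first two arguments lie in `A'`
  have comm (a b c d : A') (x : A) :
      μ a b (μ c d x) = μ (g a b c) d x + μ c (g a b d) x + μ c d (μ a b x) := by
    have h := LinearMap.congr_fun (hμrep1 a b c d) x
    simp only [LinearMap.sub_apply, Module.End.mul_apply] at h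
    rw [hμskew c (g a b d), LinearMap.neg_apply]
    linear_combination (norm := abel) h
  have deriv (a b c d : A') (x : A) :
      μ (g b c d) a x = μ c d (μ b a x) + μ d b (μ c a x) + μ b c (μ d a x) := by
    have h := LinearMap.congr_fun (hμrep2 b c d a) x
    simp only [LinearMap.add_apply, Module.End.mul_apply] at h
    linear_combination (norm := abel) h
  have deriv' (a b c d : A') (x : A) :
      μ a (g b c d) x = μ c d (μ a b x) + μ d b (μ a c x) + μ b c (μ a d x) := by
    have h := deriv a b c d x
    simp only [hμskew b a, hμskew c a, hμskew d a, hμskew (g b c d) a, map_neg,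
      LinearMap.neg_apply] at h
    linear_combination (norm := abel) -h
  have h14 := mixed a1 x2 a4 x5 x3
  have h24 := mixed' x1 a2 a4 x5 x3
  have h15 := mixed a1 x2 a5 x3 x4
  have h25 := mixed' x1 a2 a5 x3 x4
  rw [hfcyc] at h15 h25
  rw [← hfcyc] at h14 h24
  simp only [sumBracket, map_add, LinearMap.add_apply]
  linear_combination (norm := abel) hffi x1 x2 x3 x4 x5 + hc1 a1 a2 x3 x4 x5
    + inner x1 x2 x5 a3 a4 + inner x1 x2 x4 a5 a3 + inner x1 x2 x3 a4 a5
    + mixed a1 x2 a3 x4 x5 + mixed' x1 a2 a3 x4 x5 + h14 + h24 + h15 + h25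
    + comm a1 a2 a3 a4 x5 + comm a1 a2 a5 a3 x4 + comm a1 a2 a4 a5 x3
    + deriv a1 a3 a4 a5 x2 + deriv' a2 a3 a4 a5 x1

end sumBracket

/-- a matched pair of 3-Lie algebras `(A, A', ρ, μ)` gives a 3-Lie algebra
structure on the direct sum `A ⊕ A'`. -/
theorem stmt18 {k A A' : Type*} [Field k] [CharZero k]
    [AddCommGroup A] [Module k A] [AddCommGroup A'] [Module k A']
    (f : A →ₗ[k] A →ₗ[k] A →ₗ[k] A)
    (hfskew12 : ∀ x y z : A, f x y z = - f y x z)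
    (hfskew23 : ∀ x y z : A, f x y z = - f x z y)
    (hffi : ∀ x1 x2 x3 x4 x5 : A,
      f x1 x2 (f x3 x4 x5) =
        f (f x1 x2 x3) x4 x5 + f x3 (f x1 x2 x4) x5 + f x3 x4 (f x1 x2 x5))
    (g : A' →ₗ[k] A' →ₗ[k] A' →ₗ[k] A')
    (hgskew12 : ∀ a b c : A', g a b c = - g b a c)
    (hgskew23 : ∀ a b c : A', g a b c = - g a c b)
    (hgfi : ∀ a1 a2 a3 a4 a5 : A',
      g a1 a2 (g a3 a4 a5) =
        g (g a1 a2 a3) a4 a5 + g a3 (g a1 a2 a4) a5 + g a3 a4 (g a1 a2 a5))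
    (ρ : A →ₗ[k] A →ₗ[k] Module.End k A')
    (hρskew : ∀ x y : A, ρ x y = - ρ y x)
    (hρrep1 : ∀ x1 x2 x3 x4 : A,
      ρ x1 x2 * ρ x3 x4 - ρ x3 x4 * ρ x1 x2 = ρ (f x1 x2 x3) x4 - ρ (f x1 x2 x4) x3)
    (hρrep2 : ∀ x1 x2 x3 x4 : A,
      ρ (f x1 x2 x3) x4 = ρ x1 x2 * ρ x3 x4 + ρ x2 x3 * ρ x1 x4 + ρ x3 x1 * ρ x2 x4)
    (μ : A' →ₗ[k] A' →ₗ[k] Module.End k A)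
    (hμskew : ∀ a b : A', μ a b = - μ b a)
    (hμrep1 : ∀ a1 a2 a3 a4 : A',
      μ a1 a2 * μ a3 a4 - μ a3 a4 * μ a1 a2 = μ (g a1 a2 a3) a4 - μ (g a1 a2 a4) a3)
    (hμrep2 : ∀ a1 a2 a3 a4 : A',
      μ (g a1 a2 a3) a4 = μ a1 a2 * μ a3 a4 + μ a2 a3 * μ a1 a4 + μ a3 a1 * μ a2 a4)
    (hc1 : ∀ (a4 a5 : A') (x1 x2 x3 : A),
      μ a4 a5 (f x1 x2 x3) =
        f (μ a4 a5 x1) x2 x3 + f x1 (μ a4 a5 x2) x3 + f x1 x2 (μ a4 a5 x3))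
    (hc2 : ∀ (x1 x2 x4 : A) (a3 a5 : A'),
      - μ (ρ x1 x2 a3) a5 x4 =
        - μ (ρ x1 x4 a5) a3 x2 + μ (ρ x2 x4 a5) a3 x1 - f x1 x2 (μ a3 a5 x4))
    (hc3 : ∀ (a2 a3 : A') (x1 x4 x5 : A),
      f (μ a2 a3 x1) x4 x5 =
        μ a2 a3 (f x1 x4 x5) + μ (ρ x4 x5 a2) a3 x1 + μ a2 (ρ x4 x5 a3) x1)
    (hc4 : ∀ (x4 x5 : A) (a1 a2 a3 : A'),
      ρ x4 x5 (g a1 a2 a3) =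
        g (ρ x4 x5 a1) a2 a3 + g a1 (ρ x4 x5 a2) a3 + g a1 a2 (ρ x4 x5 a3))
    (hc5 : ∀ (a1 a2 a4 : A') (x3 x5 : A),
      - ρ (μ a1 a2 x3) x5 a4 =
        - ρ (μ a1 a4 x5) x3 a2 + ρ (μ a2 a4 x5) x3 a1 - g a1 a2 (ρ x3 x5 a4))
    (hc6 : ∀ (x2 x3 : A) (a1 a4 a5 : A'),
      g (ρ x2 x3 a1) a4 a5 =
        ρ x2 x3 (g a1 a4 a5) + ρ (μ a4 a5 x2) x3 a1 + ρ x2 (μ a4 a5 x3) a1) :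
    -- the bracket on `A ⊕ A'` is a 3-Lie algebra structure
    (∀ F : (A × A') → (A × A') → (A × A') → (A × A'),
      (F = fun u v w =>
        (f u.1 v.1 w.1 + μ u.2 v.2 w.1 + μ w.2 u.2 v.1 + μ v.2 w.2 u.1,
         g u.2 v.2 w.2 + ρ u.1 v.1 w.2 + ρ w.1 u.1 v.2 + ρ v.1 w.1 u.2)) →
      (∀ u v w : A × A', F u v w = - F v u w) ∧
      (∀ u v w : A × A', F u v w = - F u w v) ∧
      (∀ u1 u2 u3 u4 u5 : A × A',
        F u1 u2 (F u3 u4 u5) =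
          F (F u1 u2 u3) u4 u5 + F u3 (F u1 u2 u4) u5 + F u3 u4 (F u1 u2 u5))) := by
  rintro F rfl
  refine ⟨fun u v w => Prod.ext ?_ ?_, fun u v w => Prod.ext ?_ ?_,
    fun u1 u2 u3 u4 u5 => Prod.ext ?_ ?_⟩
  · exact sumBracket_swap_left hfskew12 hμskew _ _ _ _ _ _
  · exact sumBracket_swap_left hgskew12 hρskew _ _ _ _ _ _
  · exact sumBracket_swap_right hfskew23 hμskew _ _ _ _ _ _
  · exact sumBracket_swap_right hgskew23 hρskew _ _ _ _ _ _
  · exact sumBracket_fundamental_identity hfskew12 hfskew23 hffi g ρ hρskew hμskew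
      hμrep1 hμrep2 hc1 hc2 hc3 _ _ _ _ _ _ _ _ _ _
  · exact sumBracket_fundamental_identity hgskew12 hgskew23 hgfi f μ hμskew hρskew
      hρrep1 hρrep2 (fun x y => hc4 x y) (fun a b c x y => hc5 a b c x y)
      (fun x y a b c => hc6 x y a b c) _ _ _ _ _ _ _ _ _ _
end

section
/- Let A be a finite-dimensional 3-Lie algebra over a field of characteristic zero and Δ : A → A⊗A⊗A a linear map whose values are alternating 3-tensors, i.e. σ12(Δ(z)) = −Δ(z) and σ23(Δ(z)) = −Δ(z) for all z in A (where σ12, σ23 swap the first two, resp. last two, tensor factors). Consider the three conditions, for all x,y,z in A: (E1) Δ([x,y,z]) = (1⊗1⊗ad_{y,z})Δ(x) + (1⊗1⊗ad_{z,x})Δ(y) + (1⊗1⊗ad_{x,y})Δ(z); (E2) Δ([x,y,z]) = (1⊗1⊗ad_{y,z})Δ(x) + (1⊗ad_{y,z}⊗1)Δ(x) + (ad_{y,z}⊗1⊗1)Δ(x); (E3) (ad_{x,y}⊗1⊗1 + 1⊗1⊗ad_{x,y})Δ(z) = (1⊗ad_{z,x}⊗1)Δ(y) + (1⊗ad_{y,z}⊗1)Δ(x).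 Then any two of the conditions (E1), (E2), (E3) imply the third. -/
open TensorProduct

section

variable (k : Type*) {A : Type*} [Field k] [AddCommGroup A] [Module k A]

/-- The linear map on `A ⊗ A ⊗ A` swapping the first two tensor factors. -/
noncomputable def swap12 : ((A ⊗[k] A) ⊗[k] A) →ₗ[k] ((A ⊗[k] A) ⊗[k] A) :=
  LinearMap.rTensor A (TensorProduct.comm k A A).toLinearMap

/-- The linear map on `A ⊗ A ⊗ A` swapping the last two tensor factors. -/
noncomputable def swap23 : ((A ⊗[k] A) ⊗[k] A) →ₗ[k] ((A ⊗[k] A) ⊗[k] A) :=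
  (TensorProduct.assoc k A A A).symm.toLinearMap ∘ₗ
    (LinearMap.lTensor A (TensorProduct.comm k A A).toLinearMap) ∘ₗ
    (TensorProduct.assoc k A A A).toLinearMap

end

section

variable {k A : Type*} [Field k] [AddCommGroup A] [Module k A]

lemma swap23_lTensor (g : A →ₗ[k] A) (t : (A ⊗[k] A) ⊗[k] A) :
    swap23 k (LinearMap.lTensor (A ⊗[k] A) g t) =
      LinearMap.rTensor A (LinearMap.lTensor A g) (swap23 k t) := by
  suffices h : swap23 k ∘ₗ LinearMap.lTensor (A ⊗[k] A) g =
      LinearMap.rTensor A (LinearMap.lTensor A g) ∘ₗ swap23 k from LinearMap.congr_fun h t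
  ext a b c
  simp [swap23]

lemma swap23_rTensor_lTensor (g : A →ₗ[k] A) (t : (A ⊗[k] A) ⊗[k] A) :
    swap23 k (LinearMap.rTensor A (LinearMap.lTensor A g) t) =
      LinearMap.lTensor (A ⊗[k] A) g (swap23 k t) := by
  suffices h : swap23 k ∘ₗ LinearMap.rTensor A (LinearMap.lTensor A g) =
      LinearMap.lTensor (A ⊗[k] A) g ∘ₗ swap23 k from LinearMap.congr_fun h t
  ext a b c
  simp [swap23]

/-- For tensors that change sign under `swap23`, an expression as a sum of three linear maps
acting on the last factor is equivalent to the same expression on the middle factor. -/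
lemma eq_add_lTensor_iff_eq_add_rTensor_lTensor (g₁ g₂ g₃ : A →ₗ[k] A)
    {s t₁ t₂ t₃ : (A ⊗[k] A) ⊗[k] A} (hs : swap23 k s = -s) (h₁ : swap23 k t₁ = -t₁)
    (h₂ : swap23 k t₂ = -t₂) (h₃ : swap23 k t₃ = -t₃) :
    s = LinearMap.lTensor (A ⊗[k] A) g₁ t₁ + LinearMap.lTensor (A ⊗[k] A) g₂ t₂ +
        LinearMap.lTensor (A ⊗[k] A) g₃ t₃ ↔
      s = LinearMap.rTensor A (LinearMap.lTensor A g₁) t₁ +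
        LinearMap.rTensor A (LinearMap.lTensor A g₂) t₂ +
        LinearMap.rTensor A (LinearMap.lTensor A g₃) t₃ := by
  constructor <;> intro h <;> apply_fun swap23 k at h <;>
    simp only [map_add, swap23_lTensor, swap23_rTensor_lTensor, hs, h₁, h₂, h₃, map_neg] at h <;>
    rw [← neg_inj, h] <;> abel

end

/-- for a linear map `Δ : A → A ⊗ A ⊗ A` with alternating values on a
finite-dimensional 3-Lie algebra, any two of the conditions (E1), (E2), (E3) imply
the third. -/
theorem stmt19 {k A : Type*} [Field k] [CharZero k] [AddCommGroup A] [Module k A]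
    [FiniteDimensional k A]
    (f : A →ₗ[k] A →ₗ[k] A →ₗ[k] A)
    (hskew12 : ∀ x y z : A, f x y z = - f y x z)
    (hskew23 : ∀ x y z : A, f x y z = - f x z y)
    (hfi : ∀ x1 x2 x3 x4 x5 : A,
      f x1 x2 (f x3 x4 x5) =
        f (f x1 x2 x3) x4 x5 + f x3 (f x1 x2 x4) x5 + f x3 x4 (f x1 x2 x5))
    (Δ : A →ₗ[k] (A ⊗[k] A) ⊗[k] A)
    (halt12 : ∀ z : A, swap12 k (Δ z) = - Δ z)
    (halt23 : ∀ z : A, swap23 k (Δ z) = - Δ z) :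
    -- (E1), (E2), (E3):
    (∀ E1 E2 E3 : Prop,
      (E1 ↔ ∀ x y z : A,
        Δ (f x y z) =
          LinearMap.lTensor (A ⊗[k] A) (f y z) (Δ x)
          + LinearMap.lTensor (A ⊗[k] A) (f z x) (Δ y)
          + LinearMap.lTensor (A ⊗[k] A) (f x y) (Δ z)) →
      (E2 ↔ ∀ x y z : A,
        Δ (f x y z) =
          LinearMap.lTensor (A ⊗[k] A) (f y z) (Δ x)
          + LinearMap.rTensor A (LinearMap.lTensor A (f y z)) (Δ x)
          + LinearMap.rTensor A (LinearMap.rTensor A (f y z)) (Δ x)) →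
      (E3 ↔ ∀ x y z : A,
        LinearMap.rTensor A (LinearMap.rTensor A (f x y)) (Δ z)
          + LinearMap.lTensor (A ⊗[k] A) (f x y) (Δ z) =
          LinearMap.rTensor A (LinearMap.lTensor A (f z x)) (Δ y)
          + LinearMap.rTensor A (LinearMap.lTensor A (f y z)) (Δ x)) →
      ((E1 ∧ E2 → E3) ∧ (E1 ∧ E3 → E2) ∧ (E2 ∧ E3 → E1))) := by
  have hcyc (x y z : A) : f y z x = f x y z := by
    rw [hskew23 y z x, hskew12 y x z, neg_neg]
  have hmid (x y z : A) := eq_add_lTensor_iff_eq_add_rTensor_lTensor (f y z) (f z x) (f x y)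
    (halt23 (f x y z)) (halt23 x) (halt23 y) (halt23 z)
  intro E1 E2 E3 h1 h2 h3
  rw [h1, h2, h3]
  refine ⟨fun ⟨e1, e2⟩ x y z => ?_, fun ⟨e1, e3⟩ x y z => ?_, fun ⟨e2, e3⟩ x y z => ?_⟩
  · have p := (hmid x y z).1 (e1 x y z)
    have q := e2 z x y
    rw [← hcyc z x y, p] at q
    linear_combination (norm := abel) -q
  · have p := (hmid x y z).1 (e1 x y z)
    have q := e3 y z x
    rw [p]
    linear_combination (norm := abel) -q
  · rw [hmid]
    have q := e2 z x y
    rw [← hcyc z x y] at q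
    rw [q]
    linear_combination (norm := abel) e3 x y z
end
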